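/- (Aistleitner–Larcher–Lewko / Harman) Let δ > 0 be fixed and let 𝒜 = {a_1 < a_2 < …} be an infinite set of natural numbers such that there is a constant C with E(A_N) ≤ C·N^{3−δ} for every N ≥ 1, where A_N is the set of the first N elements of 𝒜. Then 𝒜 is metric Poissonian. -/

import Mathlib

open MeasureTheory Filter Finset
open scoped Classical

/-- Distance from a real number to the nearest integer. -/
noncomputable def intDist (x : ℝ) : ℝ := |x - round x|

/-- The pair correlation function `F(𝒜, α, s, N)` for the sequence `a` (1-indexed):
`(1/N) · #{(i,j) : 1 ≤ i,j ≤ N, i ≠ j, ‖α(a_i − a_j)‖ ≤ s/N}`. -/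
noncomputable def pairCorr (a : ℕ → ℕ) (α s : ℝ) (N : ℕ) : ℝ :=
  (((Finset.Icc 1 N ×ˢ Finset.Icc 1 N).filter
    (fun p => p.1 ≠ p.2 ∧ intDist (α * ((a p.1 : ℝ) - (a p.2 : ℝ))) ≤ s / N)).card : ℝ) / N

/-- A (strictly increasing) sequence is metric Poissonian if for a.e. `α ∈ [0,1]` and
every `s > 0`, `F(𝒜, α, s, N) → 2s`. -/
def MetricPoissonian (a : ℕ → ℕ) : Prop :=
  ∀ᵐ α ∂(volume.restrict (Set.Icc (0:ℝ) 1)),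
    ∀ s : ℝ, 0 < s → Tendsto (fun N => pairCorr a α s N) atTop (nhds (2 * s))

/-- The additive energy of a finite set of naturals: the number of quadruples
`(b₁,b₂,b₃,b₄) ∈ B⁴` with `b₁ + b₂ = b₃ + b₄`. -/
def addEnergy (B : Finset ℕ) : ℕ :=
  ((B ×ˢ B ×ˢ B ×ˢ B).filter (fun q => q.1 + q.2.1 = q.2.2.1 + q.2.2.2)).card

/-- The first `N` elements of the set associated to the (1-indexed) sequence `a`. -/
def firstN (a : ℕ → ℕ) (N : ℕ) : Finset ℕ := (Finset.Icc 1 N).image a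

/-- The increasing sequence of all primes, 1-indexed: `primeSeq 1 = 2`, `primeSeq 2 = 3`, … -/
noncomputable def primeSeq (n : ℕ) : ℕ := Nat.nth Nat.Prime (n - 1)

theorem divisor_bound (ε : ℝ) (hε : 0 < ε) :
    ∃ C : ℝ, 0 ≤ C ∧ ∀ n : ℕ, n ≠ 0 → ((Nat.divisors n).card : ℝ) ≤ C * (n : ℝ) ^ ε := by
  obtain ⟨P, hP⟩ := exists_nat_gt ((2 : ℝ) ^ (1 / ε))
  set b : ℝ := min 1 (ε * Real.log 2) with hb
  have hb0 : 0 < b := lt_min one_pos (mul_pos hε (Real.log_pos (by norm_num)))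
  have hb1 : b ≤ 1 := min_le_left _ _
  have hB1 : 1 ≤ b⁻¹ := (one_le_inv₀ hb0).2 hb1
  refine ⟨(b⁻¹) ^ P, by positivity, fun n hn => ?_⟩
  rw [Nat.card_divisors hn]
  have key : ∀ p ∈ n.primeFactors, ((n.factorization p + 1 : ℕ) : ℝ) ≤
      (if p < P then b⁻¹ else 1) * ((p : ℝ) ^ (n.factorization p)) ^ ε := by
    intro p hp
    have hp2 : 2 ≤ p := (Nat.prime_of_mem_primeFactors hp).two_le
    have hp2' : (2 : ℝ) ≤ p := by exact_mod_cast hp2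
    set k := n.factorization p
    have e1 : ((p : ℝ) ^ k) ^ ε = ((p : ℝ) ^ ε) ^ k := by
      rw [← Real.rpow_natCast, ← Real.rpow_natCast, ← Real.rpow_mul (by positivity),
        ← Real.rpow_mul (by positivity), mul_comm]
    split_ifs with h
    · have e2 : (1 : ℝ) + ε * Real.log 2 * k ≤ ((p : ℝ) ^ k) ^ ε := by
        calc (1 : ℝ) + ε * Real.log 2 * k ≤ Real.exp (ε * Real.log 2 * k) := by
              have := Real.add_one_le_exp (ε * Real.log 2 * k); linarith
          _ = ((2 : ℝ) ^ ε) ^ k := by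
              rw [Real.rpow_def_of_pos (by norm_num), ← Real.exp_nat_mul]; ring_nf
          _ ≤ _ := by rw [e1]; gcongr
      rw [inv_mul_eq_div, le_div_iff₀ hb0]
      push_cast
      have h2 : b ≤ ε * Real.log 2 := min_le_right _ _
      have : (k : ℝ) * b ≤ k * (ε * Real.log 2) := by gcongr
      nlinarith
    · rw [one_mul, e1]
      have e2 : (2 : ℝ) ≤ (p : ℝ) ^ ε := by
        have : (2 : ℝ) ^ (1 / ε) ≤ p := hP.le.trans (by exact_mod_cast not_lt.1 h)
        calc (2 : ℝ) = ((2 : ℝ) ^ (1 / ε)) ^ ε := by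
              rw [← Real.rpow_mul (by norm_num), one_div_mul_cancel hε.ne', Real.rpow_one]
          _ ≤ _ := by gcongr
      calc ((k + 1 : ℕ) : ℝ) ≤ (2 ^ k : ℕ) := by exact_mod_cast Nat.lt_two_pow_self
        _ = (2 : ℝ) ^ k := by push_cast; rfl
        _ ≤ _ := by gcongr
  push_cast at key ⊢
  refine (Finset.prod_le_prod (fun _ _ => by positivity) key).trans ?_
  rw [Finset.prod_mul_distrib]
  gcongr
  · rw [← Finset.prod_filter, Finset.prod_const]
    refine pow_le_pow_right₀ hB1 ?_
    calc _ ≤ (Finset.range P).card := Finset.card_le_card (fun p hp => by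
            simp at hp ⊢; exact hp.2)
      _ = P := by simp
  · rw [Real.finsetProd_rpow _ _ (fun _ _ => by positivity)]
    apply le_of_eq
    congr 1
    conv_rhs => rw [← Nat.prod_factorization_pow_eq_self hn]
    simp [Finsupp.prod]

open scoped ENNReal

/-- Dirichlet convolution square. -/
noncomputable def dconv (g : ℕ+ → ℝ≥0∞) (n : ℕ+) : ℝ≥0∞ :=
  ∑' a : ℕ+, ∑' b : ℕ+, if a * b = n then g a * g b else 0

noncomputable def gcdForm (V : Finset ℕ+) (f g : ℕ+ → ℝ≥0∞) : ℝ≥0∞ :=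
  ∑ v ∈ V, ∑ w ∈ V, ∑' j : ℕ+, ∑' k : ℕ+, if j * v = k * w then f v * f w * (g j * g k) else 0

theorem ennreal_cs {ι : Type*} (V : Finset ι) (f g : ι → ℝ≥0∞) :
    (∑ v ∈ V, f v * g v) ^ 2 ≤ (∑ v ∈ V, f v ^ 2) * ∑ v ∈ V, g v ^ 2 := by
  have h := ENNReal.inner_le_Lp_mul_Lq V f g (p := 2) (q := 2) ⟨by norm_num, by norm_num, by norm_num⟩
  have := pow_le_pow_left' h 2
  refine this.trans (le_of_eq ?_)
  rw [mul_pow, ← ENNReal.rpow_natCast, ← ENNReal.rpow_natCast, ← ENNReal.rpow_mul,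
    ← ENNReal.rpow_mul]
  norm_num

theorem tsum_ite_le {x : ℝ≥0∞} (p : ℕ+ → Prop) [DecidablePred p] (h : ∀ a b, p a → p b → a = b) (q : Prop) [Decidable q]
    (hq : ∀ a, p a → q) :
    (∑' k : ℕ+, if p k then x else 0) ≤ if q then x else 0 := by
  by_cases hh : ∃ a, p a
  · obtain ⟨a, ha⟩ := hh
    rw [tsum_eq_single a (fun b hb => if_neg (fun hpb => hb (h _ _ hpb ha)))]
    simp [ha, hq a ha]
  · push Not at hh
    simp [hh]

theorem gcdForm_dconv (V : Finset ℕ+) (f g : ℕ+ → ℝ≥0∞) :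
    gcdForm V f (dconv g) = ∑ v ∈ V, ∑ w ∈ V, ∑' p : ℕ+ × ℕ+, ∑' q : ℕ+ × ℕ+,
      if p.1 * p.2 * v = q.1 * q.2 * w then f v * f w * (g p.1 * g p.2 * (g q.1 * g q.2)) else 0 := by
  unfold gcdForm
  refine Finset.sum_congr rfl fun v _ => Finset.sum_congr rfl fun w _ => ?_
  have hd : ∀ n, dconv g n = ∑' p : ℕ+ × ℕ+, if p.1 * p.2 = n then g p.1 * g p.2 else 0 := by
    intro n; unfold dconv; rw [ENNReal.tsum_prod']
  have h1 : ∀ j k : ℕ+, (if j * v = k * w then f v * f w * (dconv g j * dconv g k) else 0)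
      = ∑' p : ℕ+ × ℕ+, ∑' q : ℕ+ × ℕ+, if p.1 * p.2 = j then (if q.1 * q.2 = k then
        (if p.1 * p.2 * v = q.1 * q.2 * w then f v * f w * (g p.1 * g p.2 * (g q.1 * g q.2)) else 0)
        else 0) else 0 := by
    intro j k
    rw [hd, hd, ← ENNReal.tsum_mul_right]
    simp_rw [← ENNReal.tsum_mul_left]
    split_ifs with h
    · refine tsum_congr fun p => tsum_congr fun q => ?_
      split_ifs with h1 h2 h3 <;> simp_all
    · symm
      simp only [ENNReal.tsum_eq_zero]
      intro p q
      split_ifs with h1 h2 h3 <;> simp_all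
  simp_rw [h1]
  calc _ = ∑' j : ℕ+, ∑' p : ℕ+ × ℕ+, ∑' k : ℕ+, ∑' q : ℕ+ × ℕ+, _ := by
        refine tsum_congr fun j => ?_
        rw [ENNReal.tsum_comm]
    _ = ∑' p : ℕ+ × ℕ+, ∑' j : ℕ+, ∑' k : ℕ+, ∑' q : ℕ+ × ℕ+, _ := ENNReal.tsum_comm
    _ = _ := by
      refine tsum_congr fun p => ?_
      rw [tsum_eq_single (p.1 * p.2) (by intro b hb; simp [hb.symm])]
      rw [ENNReal.tsum_comm]
      refine tsum_congr fun q => ?_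
      rw [tsum_eq_single (q.1 * q.2) (by intro b hb; simp [hb.symm])]
      simp

theorem gcdForm_sq_le (V : Finset ℕ+) (f g : ℕ+ → ℝ≥0∞) :
    gcdForm V f g ^ 2 ≤ (∑ v ∈ V, f v ^ 2) * gcdForm V f (dconv g) := by
  have e1 : gcdForm V f g = ∑ v ∈ V, f v * (∑ w ∈ V, ∑' p : ℕ+ × ℕ+,
      if p.1 * v = p.2 * w then f w * (g p.1 * g p.2) else 0) := by
    unfold gcdForm
    refine Finset.sum_congr rfl fun v _ => ?_
    rw [Finset.mul_sum]
    refine Finset.sum_congr rfl fun w _ => ?_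
    rw [ENNReal.tsum_prod', ← ENNReal.tsum_mul_left]
    refine tsum_congr fun j => ?_
    rw [← ENNReal.tsum_mul_left]
    refine tsum_congr fun k => ?_
    split_ifs <;> simp [mul_assoc]
  rw [e1]
  refine (ennreal_cs V _ _).trans ?_
  gcongr
  rw [gcdForm_dconv]
  -- expand the square
  calc _ = ∑ v ∈ V, ∑ w ∈ V, ∑ w' ∈ V, ∑' p : ℕ+ × ℕ+, ∑' q : ℕ+ × ℕ+,
        (if p.1 * v = p.2 * w then f w * (g p.1 * g p.2) else 0) *
        (if q.1 * v = q.2 * w' then f w' * (g q.1 * g q.2) else 0) := by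
        refine Finset.sum_congr rfl fun v _ => ?_
        rw [sq, Finset.sum_mul_sum]
        refine Finset.sum_congr rfl fun w _ => Finset.sum_congr rfl fun w' _ => ?_
        rw [← ENNReal.tsum_mul_right]
        simp_rw [← ENNReal.tsum_mul_left]
    _ = ∑ w ∈ V, ∑ w' ∈ V, ∑' p : ℕ+ × ℕ+, ∑' q : ℕ+ × ℕ+, ∑ v ∈ V,
        (if p.1 * v = p.2 * w then f w * (g p.1 * g p.2) else 0) *
        (if q.1 * v = q.2 * w' then f w' * (g q.1 * g q.2) else 0) := by
        rw [Finset.sum_comm]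
        refine Finset.sum_congr rfl fun w _ => ?_
        rw [Finset.sum_comm]
        refine Finset.sum_congr rfl fun w' _ => ?_
        rw [← Summable.tsum_finsetSum (fun _ _ => ENNReal.summable)]
        refine tsum_congr fun p => ?_
        rw [← Summable.tsum_finsetSum (fun _ _ => ENNReal.summable)]
    _ ≤ ∑ w ∈ V, ∑ w' ∈ V, ∑' p : ℕ+ × ℕ+, ∑' q : ℕ+ × ℕ+,
        (if p.2 * q.1 * w = q.2 * p.1 * w' then
          f w * f w' * (g p.2 * g q.1 * (g q.2 * g p.1)) else 0) := by
        refine Finset.sum_le_sum fun w _ => Finset.sum_le_sum fun w' _ =>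
          ENNReal.tsum_le_tsum fun p => ENNReal.tsum_le_tsum fun q => ?_
        have : ∀ v ∈ V, (if p.1 * v = p.2 * w then f w * (g p.1 * g p.2) else 0) *
          (if q.1 * v = q.2 * w' then f w' * (g q.1 * g q.2) else 0) =
          if (p.1 * v = p.2 * w ∧ q.1 * v = q.2 * w') then
            f w * f w' * (g p.2 * g q.1 * (g q.2 * g p.1)) else 0 := by
          intro v _
          by_cases h1 : p.1 * v = p.2 * w <;> by_cases h2 : q.1 * v = q.2 * w' <;> simp [h1, h2]
          ring
        rw [Finset.sum_congr rfl this]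
        refine (ENNReal.sum_le_tsum V).trans (tsum_ite_le _ ?_ _ ?_)
        · rintro v v' ⟨h1, _⟩ ⟨h2, _⟩
          exact mul_left_cancel (h1.trans h2.symm)
        · rintro v ⟨h1, h2⟩
          calc p.2 * q.1 * w = q.1 * (p.2 * w) := by
                rw [mul_comm p.2, mul_assoc]
            _ = q.1 * v * p.1 := by rw [← h1, mul_comm p.1, mul_assoc]
            _ = _ := by rw [h2, mul_assoc, mul_assoc, mul_comm w']
    _ = _ := by
        refine Finset.sum_congr rfl fun w _ => Finset.sum_congr rfl fun w' _ => ?_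
        rw [← ENNReal.tsum_prod (f := fun p q : ℕ+ × ℕ+ => (if p.2 * q.1 * w = q.2 * p.1 * w' then
          f w * f w' * (g p.2 * g q.1 * (g q.2 * g p.1)) else 0)),
          ← ENNReal.tsum_prod (f := fun p q : ℕ+ × ℕ+ => if p.1 * p.2 * w = q.1 * q.2 * w' then
          f w * f w' * (g p.1 * g p.2 * (g q.1 * g q.2)) else 0)]
        let e : ((ℕ+ × ℕ+) × (ℕ+ × ℕ+)) ≃ ((ℕ+ × ℕ+) × (ℕ+ × ℕ+)) :=
          { toFun := fun x => ((x.1.2, x.2.1), (x.2.2, x.1.1))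
            invFun := fun x => ((x.2.2, x.1.1), (x.1.2, x.2.1))
            left_inv := fun x => rfl
            right_inv := fun x => rfl }
        exact Equiv.tsum_eq e (fun x : (ℕ+ × ℕ+) × (ℕ+ × ℕ+) =>
          if x.1.1 * x.1.2 * w = x.2.1 * x.2.2 * w' then
          f w * f w' * (g x.1.1 * g x.1.2 * (g x.2.1 * g x.2.2)) else 0)

theorem gcdForm_le (V : Finset ℕ+) (f g : ℕ+ → ℝ≥0∞) :
    gcdForm V f g ≤ V.card * (∑ v ∈ V, f v ^ 2) * ∑' n, g n ^ 2 := by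
  have h1 : ∀ v w : ℕ+, (∑' j : ℕ+, ∑' k : ℕ+, if j * v = k * w then (g j * g k) else 0) ≤
      ∑' n, g n ^ 2 := by
    intro v w
    have h2 : ∀ x y : ℝ≥0∞, x * y ≤ 2⁻¹ * x ^ 2 + 2⁻¹ * y ^ 2 := by
      intro x y
      rcases eq_or_ne x ⊤ with rfl | hx
      · simp [ENNReal.top_pow, ENNReal.mul_top]
      rcases eq_or_ne y ⊤ with rfl | hy
      · simp [ENNReal.top_pow, ENNReal.mul_top]
      lift x to NNReal using hx
      lift y to NNReal using hy
      have h3 : x * y ≤ 2⁻¹ * x ^ 2 + 2⁻¹ * y ^ 2 := by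
        rw [← NNReal.coe_le_coe]; push_cast
        nlinarith [sq_nonneg ((x : ℝ) - y)]
      have h4 : ((2⁻¹ : NNReal) : ℝ≥0∞) = 2⁻¹ := by simp
      rw [← h4]
      exact_mod_cast h3
    calc _ ≤ ∑' j : ℕ+, ∑' k : ℕ+, ((if j * v = k * w then 2⁻¹ * g j ^ 2 else 0) +
          (if j * v = k * w then 2⁻¹ * g k ^ 2 else 0)) := by
          refine ENNReal.tsum_le_tsum fun j => ENNReal.tsum_le_tsum fun k => ?_
          split_ifs
          · exact h2 _ _
          · simp
      _ = (∑' j : ℕ+, ∑' k : ℕ+, (if j * v = k * w then 2⁻¹ * g j ^ 2 else 0)) +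
          ∑' k : ℕ+, ∑' j : ℕ+, (if j * v = k * w then 2⁻¹ * g k ^ 2 else 0) := by
          simp_rw [ENNReal.tsum_add]
          congr 1
          rw [ENNReal.tsum_comm]
      _ ≤ (∑' j : ℕ+, 2⁻¹ * g j ^ 2) + ∑' j : ℕ+, 2⁻¹ * g j ^ 2 := by
          gcongr with j k
          · refine (tsum_ite_le _ ?_ True (fun _ _ => trivial)).trans (by simp)
            intro a b ha hb
            exact mul_right_cancel (ha.symm.trans hb)
          · refine (tsum_ite_le _ ?_ True (fun _ _ => trivial)).trans (by simp)
            intro a b ha hb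
            exact mul_right_cancel (ha.trans hb.symm)
      _ = _ := by
          rw [ENNReal.tsum_mul_left, ← add_mul, ENNReal.inv_two_add_inv_two, one_mul]
  calc gcdForm V f g = ∑ v ∈ V, ∑ w ∈ V, f v * f w *
        (∑' j : ℕ+, ∑' k : ℕ+, if j * v = k * w then (g j * g k) else 0) := by
        unfold gcdForm
        refine Finset.sum_congr rfl fun v _ => Finset.sum_congr rfl fun w _ => ?_
        simp_rw [← ENNReal.tsum_mul_left, mul_ite, mul_zero]
    _ ≤ ∑ v ∈ V, ∑ w ∈ V, f v * f w * ∑' n, g n ^ 2 := by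
        refine Finset.sum_le_sum fun v _ => Finset.sum_le_sum fun w _ => ?_
        exact mul_le_mul_right (h1 v w) _
    _ = (∑ v ∈ V, 1 * f v) ^ 2 * ∑' n, g n ^ 2 := by
        simp_rw [one_mul]
        rw [sq, Finset.sum_mul_sum, Finset.sum_mul]
        simp_rw [Finset.sum_mul]
    _ ≤ _ := by
        gcongr
        refine (ennreal_cs V _ _).trans (by simp)

theorem gcdForm_iter (V : Finset ℕ+) (f g : ℕ+ → ℝ≥0∞) (m : ℕ) :
    gcdForm V f g ^ (2 ^ m) ≤ V.card * (∑ v ∈ V, f v ^ 2) ^ (2 ^ m) *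
      ∑' n, (dconv^[m] g) n ^ 2 := by
  have h : ∀ g, gcdForm V f g ^ (2 ^ m) * (∑ v ∈ V, f v ^ 2) ≤ (∑ v ∈ V, f v ^ 2) ^ (2 ^ m) *
      gcdForm V f (dconv^[m] g) := by
    induction m with
    | zero => intro g; simp [mul_comm]
    | succ m ih =>
      intro g
      rw [pow_succ, mul_comm (2 ^ m) 2, pow_mul, pow_mul, Function.iterate_succ_apply]
      calc _ ≤ ((∑ v ∈ V, f v ^ 2) * gcdForm V f (dconv g)) ^ 2 ^ m * (∑ v ∈ V, f v ^ 2) := by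
            gcongr; exact gcdForm_sq_le V f g
        _ = (∑ v ∈ V, f v ^ 2) ^ 2 ^ m * (gcdForm V f (dconv g) ^ 2 ^ m * (∑ v ∈ V, f v ^ 2)) := by
            ring
        _ ≤ (∑ v ∈ V, f v ^ 2) ^ 2 ^ m * ((∑ v ∈ V, f v ^ 2) ^ (2 ^ m) *
              gcdForm V f (dconv^[m] (dconv g))) := mul_le_mul_right (ih _) _
        _ = _ := by ring
  have hne : 2 ^ m ≠ 0 := by positivity
  rcases eq_or_ne (∑ v ∈ V, f v ^ 2) 0 with h0 | h0
  · have : gcdForm V f g = 0 := by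
      have := gcdForm_sq_le V f g
      rw [h0, zero_mul] at this
      simpa using this
    rw [this, zero_pow hne]; exact zero_le
  rcases eq_or_ne (∑ v ∈ V, f v ^ 2) ⊤ with ht | ht
  · by_cases hg : ∑' n, (dconv^[m] g) n ^ 2 = 0
    · have hh := h g
      have h2 := gcdForm_le V f (dconv^[m] g)
      rw [hg, mul_zero] at h2
      rw [le_zero_iff.1 h2, mul_zero, ht] at hh
      have h3 : gcdForm V f g ^ 2 ^ m = 0 := by
        by_contra h4
        rw [ENNReal.mul_top h4] at hh
        simp at hh
      rw [h3]; exact zero_le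
    · have : (V.card : ℝ≥0∞) ≠ 0 := by
        intro h5
        have : V = ∅ := by simpa using h5
        simp [this] at ht
      rw [ht, ENNReal.top_pow hne, ENNReal.mul_top this, ENNReal.top_mul hg]
      exact le_top
  · rw [← ENNReal.mul_le_mul_iff_left h0 ht]
    refine (h g).trans ?_
    calc _ ≤ (∑ v ∈ V, f v ^ 2) ^ 2 ^ m * (V.card * (∑ v ∈ V, f v ^ 2) * ∑' n, (dconv^[m] g) n ^ 2) := by
          gcongr; exact gcdForm_le _ _ _
      _ = _ := by ring

theorem dconv_bound (η : ℝ) (hη : 0 < η) (θ : ℝ) (m : ℕ) : ∃ C : NNReal, ∀ n : ℕ+,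
    (dconv^[m] (fun n => ENNReal.ofReal ((n : ℝ) ^ (-θ)))) n ≤
      C * ENNReal.ofReal ((n : ℝ) ^ (-θ + m * η)) := by
  induction m with
  | zero => exact ⟨1, fun n => by simp⟩
  | succ m ih =>
    obtain ⟨C, hC⟩ := ih
    obtain ⟨D, hD0, hD⟩ := divisor_bound η hη
    refine ⟨C ^ 2 * Real.toNNReal D, fun n => ?_⟩
    rw [Function.iterate_succ_apply']
    set G := (dconv^[m] (fun n => ENNReal.ofReal ((n : ℝ) ^ (-θ))))
    set X : ℝ≥0∞ := C ^ 2 * ENNReal.ofReal ((n : ℝ) ^ (-θ + m * η)) with hX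
    have h1 : dconv G n ≤ ∑' a : ℕ+, if a ∣ n then X else 0 := by
      unfold dconv
      refine ENNReal.tsum_le_tsum fun a => ?_
      calc _ ≤ ∑' b : ℕ+, if a * b = n then X else 0 := by
            refine ENNReal.tsum_le_tsum fun b => ?_
            split_ifs with h
            · refine (mul_le_mul' (hC a) (hC b)).trans (le_of_eq ?_)
              rw [hX, ← h, PNat.mul_coe]
              push_cast
              rw [Real.mul_rpow (by positivity) (by positivity), ENNReal.ofReal_mul (by positivity)]
              ring
            · rfl
        _ ≤ _ := by
          apply tsum_ite_le
          · intro b c hb hc; exact mul_left_cancel (hb.trans hc.symm)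
          · intro b hb; exact ⟨b, hb.symm⟩
    refine h1.trans ?_
    have h2 : (∑' a : ℕ+, if a ∣ n then X else 0) ≤ ∑ d ∈ Nat.divisors n, X := by
      calc _ = ∑' a : ℕ+, (fun d : ℕ => if d ∣ n then X else 0) a := by
            refine tsum_congr fun a => ?_
            simp [PNat.dvd_iff]
        _ ≤ ∑' d : ℕ, if d ∣ n then X else 0 := by
            apply ENNReal.tsum_comp_le_tsum_of_injective PNat.coe_injective
        _ = _ := by
            rw [tsum_eq_sum (s := Nat.divisors n) (by intro b hb; simp at hb; simp [hb])]
            refine Finset.sum_congr rfl fun d hd => if_pos (Nat.dvd_of_mem_divisors hd)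
    refine h2.trans ?_
    rw [Finset.sum_const, nsmul_eq_mul]
    have h3 : ((n : ℕ).divisors.card : ℝ≥0∞) ≤ ENNReal.ofReal (D * (n : ℝ) ^ η) := by
      rw [← ENNReal.ofReal_natCast]
      exact ENNReal.ofReal_le_ofReal (hD n n.ne_zero)
    calc _ ≤ ENNReal.ofReal (D * (n : ℝ) ^ η) * X := by gcongr
      _ = _ := by
        rw [hX, ENNReal.ofReal_mul hD0]
        have e : -θ + ((m + 1 : ℕ) : ℝ) * η = η + (-θ + m * η) := by push_cast; ring
        rw [e, Real.rpow_add (y := η) (by exact_mod_cast n.pos), ENNReal.ofReal_mul (by positivity)]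
        rw [ENNReal.ofReal.eq_1 D]
        push_cast
        ring

theorem gcdForm_main (θ : ℝ) (hθ : 1 / 2 < θ) (m : ℕ) : ∃ C : NNReal, ∀ (V : Finset ℕ+)
    (f : ℕ+ → ℝ≥0∞), gcdForm V f (fun n => ENNReal.ofReal ((n : ℝ) ^ (-θ))) ^ (2 ^ m) ≤
      C * V.card * (∑ v ∈ V, f v ^ 2) ^ (2 ^ m) := by
  set η : ℝ := (θ - 1 / 2) / (2 * (m + 1)) with hη
  have hη0 : 0 < η := by have : 0 < θ - 1 / 2 := by linarith
                         positivity
  have hηm : m * η ≤ (θ - 1 / 2) / 2 := by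
    rw [hη, mul_div_assoc', div_le_div_iff₀ (by positivity) (by positivity)]
    have : 0 < θ - 1 / 2 := by linarith
    nlinarith
  obtain ⟨C, hC⟩ := dconv_bound η hη0 θ m
  have hs : ∑' n : ℕ+, (dconv^[m] (fun n => ENNReal.ofReal ((n : ℝ) ^ (-θ)))) n ^ 2 ≠ ⊤ := by
    have hsum : Summable (fun n : ℕ+ => (((n : ℕ) : ℝ)) ^ (2 * (-θ + m * η))) := by
      have : Summable (fun n : ℕ => (n : ℝ) ^ (2 * (-θ + m * η))) :=
        Real.summable_nat_rpow.2 (by linarith)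
      exact this.comp_injective PNat.coe_injective
    refine ne_top_of_le_ne_top (b := (C : ℝ≥0∞) ^ 2 * ∑' n : ℕ+, ENNReal.ofReal (((n : ℕ) : ℝ) ^ (2 * (-θ + m * η)))) ?_ ?_
    · exact ENNReal.mul_ne_top (by simp) hsum.tsum_ofReal_ne_top
    · rw [← ENNReal.tsum_mul_left]
      refine ENNReal.tsum_le_tsum fun n => ?_
      refine (pow_le_pow_left' (hC n) 2).trans (le_of_eq ?_)
      rw [mul_pow, ← ENNReal.ofReal_pow (by positivity), ← Real.rpow_natCast, ← Real.rpow_mul (by positivity)]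
      push_cast
      rw [mul_comm (2 : ℝ)]
  refine ⟨(∑' n : ℕ+, (dconv^[m] (fun n => ENNReal.ofReal ((n : ℝ) ^ (-θ)))) n ^ 2).toNNReal,
    fun V f => ?_⟩
  rw [ENNReal.coe_toNNReal hs]
  refine (gcdForm_iter V f _ m).trans (le_of_eq ?_)
  ring
open scoped ENNReal in
theorem sum_sq_eq_gcdForm (V : Finset ℕ+) (f g : ℕ+ → ℝ≥0∞) :
    (∑' n : ℕ+, (∑ v ∈ V, f v * ∑' j : ℕ+, if j * v = n then g j else 0) ^ 2) = gcdForm V f g := by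
  have h1 : ∀ n : ℕ+, (∑ v ∈ V, f v * ∑' j : ℕ+, if j * v = n then g j else 0) ^ 2 =
      ∑ v ∈ V, ∑ w ∈ V, ∑' j : ℕ+, ∑' k : ℕ+, if n = k * w then
        (if j * v = k * w then f v * f w * (g j * g k) else 0) else 0 := by
    intro n
    rw [sq, Finset.sum_mul_sum]
    refine Finset.sum_congr rfl fun v _ => Finset.sum_congr rfl fun w _ => ?_
    rw [mul_mul_mul_comm, ← ENNReal.tsum_mul_right, ← ENNReal.tsum_mul_left]
    refine tsum_congr fun j => ?_
    rw [← ENNReal.tsum_mul_left, ← ENNReal.tsum_mul_left]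
    refine tsum_congr fun k => ?_
    by_cases h1 : n = k * w
    · subst h1
      by_cases h2 : j * v = k * w
      · simp [h2]
      · simp [h2]
    · simp [h1, Ne.symm h1]
  simp_rw [h1]
  unfold gcdForm
  rw [Summable.tsum_finsetSum (fun _ _ => ENNReal.summable)]
  refine Finset.sum_congr rfl fun v _ => ?_
  rw [Summable.tsum_finsetSum (fun _ _ => ENNReal.summable)]
  refine Finset.sum_congr rfl fun w _ => ?_
  rw [ENNReal.tsum_comm]
  refine tsum_congr fun j => ?_
  rw [ENNReal.tsum_comm]
  refine tsum_congr fun k => ?_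
  rw [tsum_eq_single (k * w) (by intro b hb; simp [hb])]
  simp

noncomputable def ballInd (ε : ℝ) (x : UnitAddCircle) : ℂ := if ‖x‖ ≤ ε then 1 else 0

theorem measurable_ballInd (ε : ℝ) : Measurable (ballInd ε) := by
  unfold ballInd
  exact Measurable.ite (measurableSet_le measurable_norm measurable_const) measurable_const
    measurable_const

theorem norm_ballInd_le (ε : ℝ) (x : UnitAddCircle) : ‖ballInd ε x‖ ≤ 1 := by
  unfold ballInd; split_ifs <;> simp

theorem memLp_of_bdd {f : UnitAddCircle → ℂ} (hf : Measurable f) (C : ℝ) (hC : ∀ x, ‖f x‖ ≤ C)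
    (p : ENNReal) : MemLp f p AddCircle.haarAddCircle :=
  MemLp.of_bound hf.aestronglyMeasurable C (Eventually.of_forall hC)

theorem fourierCoeff_nsmul_dvd (g : UnitAddCircle → ℂ) (hg : Measurable g) (v : ℕ+) (j : ℤ) :
    fourierCoeff (fun x => g ((v : ℕ) • x)) ((v : ℕ) * j) = fourierCoeff g j := by
  unfold fourierCoeff
  have hmp : MeasurePreserving (fun x : UnitAddCircle => ((v : ℕ) : ℤ) • x)
      AddCircle.haarAddCircle AddCircle.haarAddCircle :=
    Measure.measurePreserving_zsmul _ (by exact_mod_cast v.ne_zero)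
  have hm : AEStronglyMeasurable (fun x : UnitAddCircle => fourier (-j) x • g x)
      (Measure.map (fun x : UnitAddCircle => ((v : ℕ) : ℤ) • x) AddCircle.haarAddCircle) := by
    rw [hmp.map_eq]
    exact ((fourier (-j)).continuous.measurable.smul hg).aestronglyMeasurable
  conv_rhs => rw [← hmp.map_eq, integral_map hmp.measurable.aemeasurable hm]
  refine integral_congr_ae (Eventually.of_forall fun x => ?_)
  simp only [fourier_apply, natCast_zsmul]
  congr 3
  rw [← natCast_zsmul, smul_smul]
  congr 1
  ring

theorem fourierCoeff_nsmul_not_dvd (g : UnitAddCircle → ℂ) (v : ℕ+) (n : ℤ)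
    (hn : ¬ ((v : ℕ) : ℤ) ∣ n) :
    fourierCoeff (fun x => g ((v : ℕ) • x)) n = 0 := by
  unfold fourierCoeff
  set y : UnitAddCircle := ((1 / (v : ℕ) : ℝ) : UnitAddCircle) with hy
  have hv0 : ((v : ℕ) : ℝ) ≠ 0 := by exact_mod_cast v.ne_zero
  have hvy : (v : ℕ) • y = 0 := by
    rw [hy, ← AddCircle.coe_nsmul]
    rw [nsmul_eq_mul, mul_one_div_cancel hv0]
    exact AddCircle.coe_period 1
  set I := ∫ t : UnitAddCircle, fourier (-n) t • g ((v : ℕ) • t) ∂AddCircle.haarAddCircle with hI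
  have h1 : I = fourier (-n) y * I := by
    conv_lhs => rw [hI, ← integral_add_right_eq_self _ y]
    rw [hI, ← integral_const_mul]
    refine integral_congr_ae (Eventually.of_forall fun x => ?_)
    simp only [smul_add, hvy, add_zero, smul_eq_mul]
    rw [fourier_apply, fourier_apply, fourier_apply, smul_add, AddCircle.toCircle_add]
    push_cast
    ring
  have h2 : fourier (-n) y ≠ 1 := by
    intro h
    rw [hy, fourier_coe_apply, Complex.exp_eq_one_iff] at h
    obtain ⟨k, hk⟩ := h
    apply hn
    refine ⟨-k, ?_⟩
    have hpi : (2 * Real.pi * Complex.I : ℂ) ≠ 0 := Complex.two_pi_I_ne_zero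
    have hvC : ((v : ℕ) : ℂ) ≠ 0 := by exact_mod_cast v.ne_zero
    have : (-n : ℂ) = k * (v : ℕ) := by
      apply mul_left_cancel₀ hpi
      push_cast at hk
      field_simp at hk
      linear_combination (2 * Real.pi * Complex.I) * hk
    have h3 : (-n : ℤ) = k * (v : ℕ) := by exact_mod_cast this
    linarith
  have h3 : (1 - fourier (-n) y) * I = 0 := by linear_combination h1
  rcases mul_eq_zero.1 h3 with h | h
  · exact absurd (by linear_combination -h) h2
  · exact h

theorem fourierCoeff_ballInd (ε : ℝ) (h0 : 0 < ε) (h1 : ε < 1 / 2) (j : ℤ) :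
    fourierCoeff (ballInd ε) j = ∫ x in (-ε)..ε, Complex.exp (((-2 * Real.pi * j : ℝ) * Complex.I) * x) := by
  rw [fourierCoeff_eq_intervalIntegral _ _ (-1 / 2)]
  have e : (-1 / 2 : ℝ) + 1 = 1 / 2 := by norm_num
  rw [e, one_div_one, one_smul, intervalIntegral.integral_of_le (by norm_num),
    intervalIntegral.integral_of_le (by linarith), ← integral_Icc_eq_integral_Ioc,
    ← integral_Icc_eq_integral_Ioc,
    ← integral_indicator measurableSet_Icc, ← integral_indicator measurableSet_Icc]
  refine integral_congr_ae (Eventually.of_forall fun x => ?_)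
  simp only [Set.indicator]
  by_cases hx : x ∈ Set.Icc (-ε) ε
  · have hx' : x ∈ Set.Icc (-1 / 2 : ℝ) (1 / 2) := ⟨by linarith [hx.1], by linarith [hx.2]⟩
    rw [if_pos hx, if_pos hx']
    have hn : ‖(x : UnitAddCircle)‖ = |x| := by
      rw [AddCircle.norm_coe_eq_abs_iff _ one_ne_zero, abs_one, abs_le]
      exact ⟨by linarith [hx'.1], hx'.2⟩
    rw [ballInd, if_pos (by rw [hn, abs_le]; exact hx), fourier_coe_apply]
    simp only [smul_eq_mul, mul_one]
    congr 1
    push_cast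
    ring
  · rw [if_neg hx]
    by_cases hx' : x ∈ Set.Icc (-1 / 2 : ℝ) (1 / 2)
    · rw [if_pos hx']
      have hn : ‖(x : UnitAddCircle)‖ = |x| := by
        rw [AddCircle.norm_coe_eq_abs_iff _ one_ne_zero, abs_one, abs_le]
        exact ⟨by linarith [hx'.1], hx'.2⟩
      rw [ballInd, if_neg (by rw [hn, abs_le]; exact hx), smul_zero]
    · rw [if_neg hx']

theorem fourierCoeff_ballInd_zero (ε : ℝ) (h0 : 0 < ε) (h1 : ε < 1 / 2) :
    fourierCoeff (ballInd ε) 0 = 2 * ε := by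
  rw [fourierCoeff_ballInd ε h0 h1]
  simp
  ring

theorem fourierCoeff_ballInd_bound (ε : ℝ) (h0 : 0 < ε) (h1 : ε < 1 / 2) (j : ℤ) (hj : j ≠ 0)
    (θ : ℝ) (hθ0 : 0 ≤ θ) (hθ1 : θ ≤ 1) :
    ‖fourierCoeff (ballInd ε) j‖ ≤ (2 * ε) ^ (1 - θ) * ((j.natAbs : ℝ)) ^ (-θ) := by
  have hj1 : (1 : ℝ) ≤ |(j : ℝ)| := by exact_mod_cast Int.one_le_abs hj
  have hja : ((j.natAbs : ℕ) : ℝ) = |(j : ℝ)| := by rw [Nat.cast_natAbs]; push_cast; rfl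
  have b1 : ‖fourierCoeff (ballInd ε) j‖ ≤ 2 * ε := by
    rw [fourierCoeff_ballInd ε h0 h1]
    have := intervalIntegral.norm_integral_le_of_norm_le_const (a := -ε) (b := ε) (C := 1)
      (f := fun x : ℝ => Complex.exp (((-2 * Real.pi * j : ℝ) * Complex.I) * x)) (by
        intro x _
        have : ((-2 * Real.pi * j : ℝ) * Complex.I) * x = ((-2 * Real.pi * j * x : ℝ)) * Complex.I := by
          push_cast; ring
        rw [this, Complex.norm_exp_ofReal_mul_I])
    refine this.trans (le_of_eq ?_)
    rw [abs_of_pos (by linarith)]; ring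
  have b2 : ‖fourierCoeff (ballInd ε) j‖ ≤ |(j : ℝ)|⁻¹ := by
    rw [fourierCoeff_ballInd ε h0 h1]
    have hc : ((-2 * Real.pi * j : ℝ) * Complex.I : ℂ) ≠ 0 := by
      apply mul_ne_zero _ Complex.I_ne_zero
      exact_mod_cast mul_ne_zero (by simp [Real.pi_ne_zero]) (by exact_mod_cast hj)
    rw [integral_exp_mul_complex hc, norm_div]
    have hnc : ‖((-2 * Real.pi * j : ℝ) * Complex.I : ℂ)‖ = 2 * Real.pi * |(j : ℝ)| := by
      rw [norm_mul, Complex.norm_I, mul_one, Complex.norm_real, Real.norm_eq_abs, abs_mul, abs_mul,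
        abs_of_pos Real.pi_pos]
      norm_num
    have hn2 : ∀ x : ℝ, ‖Complex.exp (((-2 * Real.pi * j : ℝ) * Complex.I) * x)‖ = 1 := by
      intro x
      have : ((-2 * Real.pi * j : ℝ) * Complex.I) * x = ((-2 * Real.pi * j * x : ℝ)) * Complex.I := by
          push_cast; ring
      rw [this, Complex.norm_exp_ofReal_mul_I]
    rw [hnc, div_le_iff₀ (by positivity)]
    refine (norm_sub_le _ _).trans ?_
    rw [hn2, hn2, mul_comm, mul_assoc, mul_inv_cancel₀ (by positivity)]
    linarith [Real.pi_gt_three]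
  rw [hja]
  calc ‖fourierCoeff (ballInd ε) j‖
      = ‖fourierCoeff (ballInd ε) j‖ ^ (1 - θ) * ‖fourierCoeff (ballInd ε) j‖ ^ θ := by
        rw [← Real.rpow_add_of_nonneg (norm_nonneg _) (by linarith) hθ0]
        simp
    _ ≤ (2 * ε) ^ (1 - θ) * (|(j : ℝ)|⁻¹) ^ θ := by
        gcongr
    _ = _ := by rw [Real.rpow_neg (abs_nonneg _), Real.inv_rpow (abs_nonneg _)]

open scoped ENNReal in
theorem fourierCoeff_dilate_bound (ε : ℝ) (h0 : 0 < ε) (h1 : ε < 1 / 2) (v m : ℕ+) (n : ℤ)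
    (hn : n.natAbs = m) (θ : ℝ) (hθ0 : 0 ≤ θ) (hθ1 : θ ≤ 1) :
    ENNReal.ofReal ‖fourierCoeff (fun x => ballInd ε ((v : ℕ) • x)) n‖ ≤
      ENNReal.ofReal ((2 * ε) ^ (1 - θ)) *
        ∑' j : ℕ+, if j * v = m then ENNReal.ofReal ((j : ℝ) ^ (-θ)) else 0 := by
  by_cases hd : ((v : ℕ) : ℤ) ∣ n
  · obtain ⟨j, rfl⟩ := hd
    rw [fourierCoeff_nsmul_dvd _ (measurable_ballInd ε)]
    have hj : j ≠ 0 := by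
      rintro rfl
      simp at hn
      exact m.ne_zero hn.symm
    refine (ENNReal.ofReal_le_ofReal (fourierCoeff_ballInd_bound ε h0 h1 j hj θ hθ0 hθ1)).trans ?_
    rw [ENNReal.ofReal_mul (by positivity)]
    gcongr
    let k : ℕ+ := ⟨j.natAbs, Int.natAbs_pos.2 hj⟩
    have hk : k * v = m := by
      apply PNat.coe_injective
      rw [PNat.mul_coe, ← hn, Int.natAbs_mul, Int.natAbs_natCast, mul_comm]
      rfl
    refine le_trans ?_ (ENNReal.le_tsum k)
    rw [if_pos hk]
    rfl
  · rw [fourierCoeff_nsmul_not_dvd _ _ _ hd]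
    simp

theorem fourierCoeff_const_of_ne (c : ℂ) (n : ℤ) (hn : n ≠ 0) :
    fourierCoeff (fun _ : UnitAddCircle => c) n = 0 := by
  have := fourierCoeff_nsmul_not_dvd (fun _ => c) ⟨n.natAbs + 1, by omega⟩ n (by
    intro h
    have := Int.natAbs_dvd_natAbs.2 h
    have h2 : n.natAbs + 1 ≤ n.natAbs := Nat.le_of_dvd (Int.natAbs_pos.2 hn) this
    omega)
  exact this

set_option maxHeartbeats 1000000 in
open scoped ENNReal in
theorem variance_bound {ι : Type*} (P : Finset ι) (d : ι → ℕ+) (ε : ℝ) (h0 : 0 < ε)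
    (h1 : ε < 1 / 2) (θ : ℝ) (hθ0 : 0 ≤ θ) (hθ1 : θ ≤ 1) :
    ∫⁻ x : UnitAddCircle, ENNReal.ofReal (‖(∑ p ∈ P, ballInd ε ((d p : ℕ) • x)) - P.card * (2 * ε)‖ ^ 2)
      ∂AddCircle.haarAddCircle ≤ 2 * ENNReal.ofReal ((2 * ε) ^ (1 - θ)) ^ 2 *
      gcdForm (P.image d) (fun v => ((P.filter (fun p => d p = v)).card : ℝ≥0∞))
        (fun n => ENNReal.ofReal ((n : ℝ) ^ (-θ))) := by
  set G : UnitAddCircle → ℂ := fun x => (∑ p ∈ P, ballInd ε ((d p : ℕ) • x)) - P.card * (2 * ε) with hG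
  have hmI : ∀ v : ℕ, Measurable (fun x : UnitAddCircle => ballInd ε (v • x)) := fun v =>
    (measurable_ballInd ε).comp (continuous_const_smul v).measurable
  have hGm : Measurable G := by
    refine Measurable.sub_const (Finset.measurable_sum _ fun p _ => hmI _) _
  have hGb : ∀ x, ‖G x‖ ≤ P.card + ‖(P.card * (2 * ε) : ℂ)‖ := by
    intro x
    refine (norm_sub_le _ _).trans ?_
    gcongr
    refine (norm_sum_le _ _).trans ?_
    refine (Finset.sum_le_sum fun p _ => norm_ballInd_le _ _).trans (by simp)
  have hL : MemLp G 2 AddCircle.haarAddCircle := memLp_of_bdd hGm _ hGb 2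
  have hpars := hasSum_sq_fourierCoeff (MemLp.toLp G hL)
  have e1 : ∀ i, fourierCoeff ((MemLp.toLp G hL)) i = fourierCoeff G i := fun i =>
    congrFun (fourierCoeff_congr_ae hL.coeFn_toLp) i
  have e2 : ∫ t, ‖(MemLp.toLp G hL) t‖ ^ 2 ∂AddCircle.haarAddCircle = ∫ t, ‖G t‖ ^ 2 ∂AddCircle.haarAddCircle := by
    apply integral_congr_ae
    filter_upwards [hL.coeFn_toLp] with x hx
    rw [hx]
  simp_rw [e1] at hpars
  rw [e2] at hpars
  have hInteg : Integrable (fun t => ‖G t‖ ^ 2) AddCircle.haarAddCircle := hL.integrable_norm_pow (by norm_num)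
  rw [← ofReal_integral_eq_lintegral_ofReal hInteg (Eventually.of_forall fun x => by positivity),
    ← hpars.tsum_eq, ENNReal.ofReal_tsum_of_nonneg (fun _ => by positivity) hpars.summable]
  -- Fourier coefficients of G
  have hG' : G = (fun x => ∑ p ∈ P, ballInd ε ((d p : ℕ) • x)) + fun _ => -(P.card * (2 * ε) : ℂ) := by
    ext x; simp [hG, sub_eq_add_neg]
  have hIint : ∀ v : ℕ, Integrable (fun x : UnitAddCircle => ballInd ε (v • x)) AddCircle.haarAddCircle := fun v =>
    memLp_one_iff_integrable.1 (memLp_of_bdd (hmI v) 1 (fun x => norm_ballInd_le _ _) 1)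
  have hcoef : ∀ n, fourierCoeff G n = (∑ p ∈ P, fourierCoeff (fun x => ballInd ε ((d p : ℕ) • x)) n) +
      fourierCoeff (fun _ : UnitAddCircle => -(P.card * (2 * ε) : ℂ)) n := by
    intro n
    have hadd := fourierCoeff.add (f := fun x : UnitAddCircle => ∑ p ∈ P, ballInd ε ((d p : ℕ) • x))
      (g := fun _ : UnitAddCircle => -(P.card * (2 * ε) : ℂ))
      (integrable_finsetSum _ fun p _ => hIint _) (integrable_const _)
    rw [hG', hadd, Pi.add_apply]
    congr 1
    have hs := fourierCoeff.sum P (fun p (x : UnitAddCircle) => ballInd ε ((d p : ℕ) • x)) (fun p _ => hIint _)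
    have e3 : (fun x : UnitAddCircle => ∑ p ∈ P, ballInd ε ((d p : ℕ) • x)) = ∑ p ∈ P, fun (x : UnitAddCircle) => ballInd ε ((d p : ℕ) • x) := by
      ext x; simp
    rw [e3, hs]
    simp
  have hc0 : fourierCoeff G 0 = 0 := by
    rw [hcoef]
    have : ∀ p ∈ P, fourierCoeff (fun x => ballInd ε ((d p : ℕ) • x)) 0 = 2 * ε := by
      intro p _
      have := fourierCoeff_nsmul_dvd (ballInd ε) (measurable_ballInd ε) (d p) 0
      rw [mul_zero] at this
      rw [this, fourierCoeff_ballInd_zero ε h0 h1]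
    rw [Finset.sum_congr rfl this]
    simp [fourierCoeff]
  set B := ENNReal.ofReal ((2 * ε) ^ (1 - θ)) with hB
  set r : ℕ+ → ℝ≥0∞ := fun v => ((P.filter (fun p => d p = v)).card : ℝ≥0∞) with hr
  set H : ℕ+ → ℝ≥0∞ := fun m => B ^ 2 * (∑ v ∈ P.image d, r v * ∑' j : ℕ+, if j * v = m then
    ENNReal.ofReal ((j : ℝ) ^ (-θ)) else 0) ^ 2 with hH
  have hcb : ∀ (n : ℤ) (m : ℕ+), n.natAbs = m → ENNReal.ofReal (‖fourierCoeff G n‖ ^ 2) ≤ H m := by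
    intro n m hnm
    have hn0 : n ≠ 0 := by
      rintro rfl
      exact m.ne_zero (by simpa using hnm.symm)
    rw [hcoef, fourierCoeff_const_of_ne _ _ hn0, add_zero, ENNReal.ofReal_pow (norm_nonneg _), hH]
    simp only
    rw [← mul_pow]
    gcongr
    calc _ ≤ ENNReal.ofReal (∑ p ∈ P, ‖fourierCoeff (fun x => ballInd ε ((d p : ℕ) • x)) n‖) :=
          ENNReal.ofReal_le_ofReal (norm_sum_le _ _)
      _ = ∑ p ∈ P, ENNReal.ofReal ‖fourierCoeff (fun x => ballInd ε ((d p : ℕ) • x)) n‖ :=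
          ENNReal.ofReal_sum_of_nonneg (fun _ _ => norm_nonneg _)
      _ ≤ ∑ p ∈ P, B * ∑' j : ℕ+, if j * d p = m then ENNReal.ofReal ((j : ℝ) ^ (-θ)) else 0 :=
          Finset.sum_le_sum fun p _ => fourierCoeff_dilate_bound ε h0 h1 (d p) m n hnm θ hθ0 hθ1
      _ = _ := by
          rw [← Finset.mul_sum, Finset.sum_comp (fun v : ℕ+ => ∑' j : ℕ+, if j * v = m then ENNReal.ofReal ((j : ℝ) ^ (-θ)) else 0) d]
          simp only [nsmul_eq_mul, hr]
  rw [tsum_of_nat_of_neg_add_one ENNReal.summable ENNReal.summable, tsum_eq_zero_add' ENNReal.summable]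
  have hfin : ∑' m : ℕ+, H m = B ^ 2 * gcdForm (P.image d) r (fun n => ENNReal.ofReal ((n : ℝ) ^ (-θ))) := by
    rw [hH, ENNReal.tsum_mul_left, sum_sq_eq_gcdForm]
  have hsucc : ∑' m : ℕ+, H m = ∑' n : ℕ, H n.succPNat := by
    rw [← Equiv.tsum_eq Equiv.pnatEquivNat.symm]
    rfl
  rw [mul_assoc, ← hfin, two_mul, hsucc]
  simp only [Nat.cast_zero, hc0]
  rw [norm_zero, zero_pow two_ne_zero, ENNReal.ofReal_zero, zero_add]
  refine add_le_add ?_ ?_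
  · exact ENNReal.tsum_le_tsum fun n => hcb _ _ (by simp; omega)
  · exact ENNReal.tsum_le_tsum fun n => hcb _ _ (by simp; omega)
/-- Ordered pairs with second index smaller. -/
def pairSet (N : ℕ) : Finset (ℕ × ℕ) :=
  (Finset.Icc 1 N ×ˢ Finset.Icc 1 N).filter (fun p => p.2 < p.1)

def pairDiff (a : ℕ → ℕ) (p : ℕ × ℕ) : ℕ+ := (a p.1 - a p.2).toPNat'

noncomputable def pairCnt (a : ℕ → ℕ) (x : UnitAddCircle) (N : ℕ) (ε : ℝ) : ℝ :=
  (((pairSet N).filter (fun p => ‖(pairDiff a p : ℕ) • x‖ ≤ ε)).card : ℝ)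

theorem pairDiff_coe (a : ℕ → ℕ) (ha : StrictMono a) (N : ℕ) (p : ℕ × ℕ) (hp : p ∈ pairSet N) :
    (pairDiff a p : ℕ) = a p.1 - a p.2 ∧ a p.2 < a p.1 := by
  simp only [pairSet, Finset.mem_filter] at hp
  have := ha hp.2
  refine ⟨?_, this⟩
  rw [pairDiff, Nat.toPNat'_coe, if_pos (by omega)]

theorem card_symm (N : ℕ) (Q : ℕ × ℕ → Prop) (hQ : ∀ i j, Q (i, j) ↔ Q (j, i)) :
    ((Finset.Icc 1 N ×ˢ Finset.Icc 1 N).filter (fun p => p.1 ≠ p.2 ∧ Q p)).card =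
      2 * ((pairSet N).filter Q).card := by
  have h1 : (Finset.Icc 1 N ×ˢ Finset.Icc 1 N).filter (fun p => p.1 ≠ p.2 ∧ Q p) =
      (pairSet N).filter Q ∪ ((pairSet N).filter Q).map (Equiv.prodComm ℕ ℕ).toEmbedding := by
    ext ⟨i, j⟩
    simp only [Finset.mem_filter, Finset.mem_union, Finset.mem_map_equiv, pairSet,
      Finset.mem_product, Equiv.prodComm_symm, Equiv.prodComm_apply, Prod.swap_prod_mk, ne_eq]
    rw [hQ j i]
    constructor
    · rintro ⟨⟨h1, h2⟩, h3, h4⟩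
      rcases lt_or_gt_of_ne h3 with h | h
      · exact Or.inr ⟨⟨⟨h2, h1⟩, h⟩, h4⟩
      · exact Or.inl ⟨⟨⟨h1, h2⟩, h⟩, h4⟩
    · rintro (⟨⟨⟨h1, h2⟩, h⟩, h4⟩ | ⟨⟨⟨h2, h1⟩, h⟩, h4⟩)
      · exact ⟨⟨h1, h2⟩, by omega, h4⟩
      · exact ⟨⟨h1, h2⟩, by omega, h4⟩
  rw [h1, Finset.card_union_of_disjoint, Finset.card_map]
  · ring
  · rw [Finset.disjoint_left]
    rintro ⟨i, j⟩ h2 h3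
    simp only [Finset.mem_filter, Finset.mem_map_equiv, pairSet,
      Equiv.prodComm_symm, Equiv.prodComm_apply, Prod.swap_prod_mk] at h2 h3
    omega

theorem pairCorr_eq (a : ℕ → ℕ) (ha : StrictMono a) (α s : ℝ) (N : ℕ) :
    pairCorr a α s N = 2 * pairCnt a (α : UnitAddCircle) N (s / N) / N := by
  have hd : ∀ x : ℝ, intDist x = ‖(x : UnitAddCircle)‖ := fun x => by
    rw [UnitAddCircle.norm_eq]; rfl
  unfold pairCorr pairCnt
  congr 1
  rw [card_symm N (fun p => intDist (α * ((a p.1 : ℝ) - (a p.2 : ℝ))) ≤ s / N)]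
  · push_cast
    congr 3
    apply Finset.filter_congr
    intro p hp
    obtain ⟨h1, h2⟩ := pairDiff_coe a ha N p hp
    rw [hd, ← AddCircle.coe_nsmul, h1, nsmul_eq_mul, Nat.cast_sub h2.le, mul_comm]
  · intro i j
    simp only [hd]
    rw [← norm_neg, ← AddCircle.coe_neg]
    have : -(α * ((a i : ℝ) - a j)) = α * ((a j : ℝ) - a i) := by ring
    rw [this]

theorem card_pairSet (N : ℕ) : 2 * ((pairSet N).card : ℝ) = N * (N - 1) := by
  have h : (Finset.Icc 1 N).offDiag.card = 2 * (pairSet N).card := by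
    have h0 := card_symm N (fun _ => True) (by simp)
    convert h0 using 2
    · ext p; simp [Finset.mem_offDiag, and_assoc]
    · simp
  rw [Finset.offDiag_card] at h
  simp only [Nat.card_Icc, Nat.add_sub_cancel] at h
  have h3 : N * N = 2 * (pairSet N).card + N := by
    have : N ≤ N * N := Nat.le_mul_self N
    omega
  have h4 : (N : ℝ) * N = 2 * (pairSet N).card + N := by exact_mod_cast h3
  linarith

theorem card_image_le_sq (a : ℕ → ℕ) (N : ℕ) : ((pairSet N).image (pairDiff a)).card ≤ N ^ 2 := by
  refine Finset.card_image_le.trans ((Finset.card_filter_le _ _).trans ?_)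
  simp [sq]

theorem sum_sq_le_energy (a : ℕ → ℕ) (ha : StrictMono a) (N : ℕ) :
    ∑ v ∈ (pairSet N).image (pairDiff a), ((pairSet N).filter (fun p => pairDiff a p = v)).card ^ 2 ≤
      _root_.addEnergy (firstN a N) := by
  have h1 : ∑ v ∈ (pairSet N).image (pairDiff a),
      ((pairSet N).filter (fun p => pairDiff a p = v)).card ^ 2 =
      ((pairSet N ×ˢ pairSet N).filter (fun q => pairDiff a q.1 = pairDiff a q.2)).card := by
    rw [Finset.card_eq_sum_card_fiberwise (f := fun q => pairDiff a q.1) (t := (pairSet N).image (pairDiff a))]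
    · refine Finset.sum_congr rfl fun v _ => ?_
      rw [sq, ← Finset.card_product]
      congr 1
      ext q
      simp only [Finset.mem_product, Finset.mem_filter]
      constructor
      · rintro ⟨⟨h1, h2⟩, h3, h4⟩
        exact ⟨⟨⟨h1, h3⟩, h2.trans h4.symm⟩, h2⟩
      · rintro ⟨⟨⟨h1, h3⟩, h2⟩, h4⟩
        exact ⟨⟨h1, h4⟩, h3, h2.symm.trans h4⟩
    · intro q hq
      simp only [Finset.coe_filter, Finset.mem_product, Set.mem_ofPred_eq] at hq
      exact Finset.mem_coe.2 (Finset.mem_image_of_mem _ hq.1.1)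
  rw [h1]
  unfold _root_.addEnergy
  apply Finset.card_le_card_of_injOn
    (fun q => (a q.1.1, a q.2.2, a q.2.1, a q.1.2))
  · intro q hq
    simp only [Finset.coe_filter, Finset.mem_product, Set.mem_ofPred_eq] at hq
    obtain ⟨⟨h2, h3⟩, h4⟩ := hq
    obtain ⟨e1, l1⟩ := pairDiff_coe a ha N _ h2
    obtain ⟨e2, l2⟩ := pairDiff_coe a ha N _ h3
    rw [h4] at e1
    simp only [pairSet, Finset.mem_filter, Finset.mem_product] at h2 h3
    simp only [Finset.coe_filter, Finset.mem_product, Set.mem_ofPred_eq, firstN]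
    refine ⟨⟨Finset.mem_image_of_mem _ h2.1.1, Finset.mem_image_of_mem _ h3.1.2,
      Finset.mem_image_of_mem _ h3.1.1, Finset.mem_image_of_mem _ h2.1.2⟩, ?_⟩
    omega
  · rintro ⟨⟨i, j⟩, ⟨k, l⟩⟩ _ ⟨⟨i', j'⟩, ⟨k', l'⟩⟩ _ h
    simp only [Prod.mk.injEq] at h ⊢
    obtain ⟨h1, h2, h3, h4⟩ := h
    exact ⟨⟨ha.injective h1, ha.injective h4⟩, ha.injective h3, ha.injective h2⟩

open scoped ENNReal in
theorem var_N (δ : ℝ) (hδ : 0 < δ) (hδ1 : δ ≤ 1)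
    (a : ℕ → ℕ) (ha : StrictMono a) (C : ℝ)
    (h : ∀ N : ℕ, 1 ≤ N → (addEnergy (firstN a N) : ℝ) ≤ C * (N : ℝ) ^ ((3 : ℝ) - δ))
    (s : ℝ) (hs : 0 < s) : ∃ K : ℝ, 0 ≤ K ∧ ∀ N : ℕ, 1 ≤ N → 2 * s < N →
    ∫⁻ x : UnitAddCircle, ENNReal.ofReal (‖(∑ p ∈ pairSet N, ballInd (s / N) ((pairDiff a p : ℕ) • x))
      - (pairSet N).card * (2 * (s / N : ℝ))‖ ^ 2)
      ∂AddCircle.haarAddCircle ≤ ENNReal.ofReal (K * (N : ℝ) ^ (2 - δ / 2)) := by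
  have hC0 : 0 ≤ C := by
    have := h 1 le_rfl
    simp at this
    exact le_trans (by positivity) this
  obtain ⟨m, hm⟩ := exists_pow_lt_of_lt_one (show (0 : ℝ) < δ / 8 by positivity)
    (show (1 / 2 : ℝ) < 1 by norm_num)
  set θ : ℝ := 1 / 2 + δ / 8 with hθ
  obtain ⟨c, hc⟩ := gcdForm_main θ (by linarith) m
  set M : ℕ := 2 ^ m with hM
  have hM0 : M ≠ 0 := by positivity
  set c' : ℝ := max 1 (c : ℝ) with hc'
  have hc1 : 1 ≤ c' := le_max_left _ _
  have hcc : (c : ℝ) ≤ c' ^ M := (le_max_right _ _).trans (le_self_pow₀ hc1 hM0)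
  refine ⟨2 * ((2 * s) ^ (1 - θ)) ^ 2 * (c' * C), by positivity, fun N hN hsN => ?_⟩
  have hN0 : (0 : ℝ) < N := by exact_mod_cast hN
  have hN1 : (1 : ℝ) ≤ N := by exact_mod_cast hN
  have hv := variance_bound (pairSet N) (pairDiff a) (s / N) (by positivity)
    (by rw [div_lt_iff₀ hN0]; linarith) θ (by linarith) (by linarith)
  refine hv.trans ?_
  set Q := gcdForm ((pairSet N).image (pairDiff a))
    (fun v => (((pairSet N).filter (fun p => pairDiff a p = v)).card : ℝ≥0∞))
        (fun n => ENNReal.ofReal ((n : ℝ) ^ (-θ))) with hQ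
  have hQM : Q ≤ ENNReal.ofReal (c' * (N : ℝ) ^ (2 / (M : ℝ)) * (C * (N : ℝ) ^ (3 - δ))) := by
    rw [← ENNReal.pow_le_pow_left_iff hM0]
    refine (hc _ _).trans ?_
    rw [← ENNReal.ofReal_pow (by positivity), mul_pow, mul_pow, ENNReal.ofReal_mul (by positivity),
      ENNReal.ofReal_mul (by positivity), ENNReal.ofReal_pow (p := C * _) (by positivity)]
    gcongr
    · rw [← ENNReal.ofReal_coe_nnreal]
      exact ENNReal.ofReal_le_ofReal hcc
    · rw [← Real.rpow_natCast ((N : ℝ) ^ _), ← Real.rpow_mul hN0.le, div_mul_cancel₀ _ (by exact_mod_cast hM0),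
        ← ENNReal.ofReal_natCast]
      apply ENNReal.ofReal_le_ofReal
      have := card_image_le_sq a N
      rw [Real.rpow_two]
      exact_mod_cast this
    · have h1 := sum_sq_le_energy a ha N
      have h2 : ((∑ v ∈ (pairSet N).image (pairDiff a),
        ((pairSet N).filter (fun p => pairDiff a p = v)).card ^ 2 : ℕ) : ℝ) ≤ C * (N : ℝ) ^ (3 - δ) :=
        le_trans (by exact_mod_cast h1) (h N hN)
      have h3 := ENNReal.ofReal_le_ofReal h2
      rw [ENNReal.ofReal_natCast] at h3
      push_cast at h3
      exact h3
  calc _ ≤ 2 * ENNReal.ofReal ((2 * (s / N)) ^ (1 - θ)) ^ 2 *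
        ENNReal.ofReal (c' * (N : ℝ) ^ (2 / (M : ℝ)) * (C * (N : ℝ) ^ (3 - δ))) := by gcongr
    _ = ENNReal.ofReal (2 * ((2 * (s / N)) ^ (1 - θ)) ^ 2 *
        (c' * (N : ℝ) ^ (2 / (M : ℝ)) * (C * (N : ℝ) ^ (3 - δ)))) := by
        rw [ENNReal.ofReal_mul (p := 2 * ((2 * (s / N)) ^ (1 - θ)) ^ 2) (by positivity),
          ENNReal.ofReal_mul (p := 2) (by positivity), ENNReal.ofReal_pow (by positivity)]
        simp
    _ ≤ _ := by
        apply ENNReal.ofReal_le_ofReal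
        have e1 : ((2 * (s / N)) ^ (1 - θ)) ^ 2 = ((2 * s) ^ (1 - θ)) ^ 2 * (N : ℝ) ^ (-2 * (1 - θ)) := by
          rw [← mul_div_assoc, Real.div_rpow (by positivity) hN0.le, div_pow,
            ← Real.rpow_natCast ((N : ℝ) ^ _), ← Real.rpow_mul hN0.le, div_eq_mul_inv,
            ← Real.rpow_neg hN0.le]
          congr 2
          push_cast; ring
        rw [e1]
        have e2 : 2 * (((2 * s) ^ (1 - θ)) ^ 2 * (N : ℝ) ^ (-2 * (1 - θ))) *
          (c' * (N : ℝ) ^ (2 / (M : ℝ)) * (C * (N : ℝ) ^ (3 - δ))) =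
          2 * ((2 * s) ^ (1 - θ)) ^ 2 * (c' * C) * (N : ℝ) ^ (-2 * (1 - θ) + 2 / (M : ℝ) + (3 - δ)) := by
          rw [Real.rpow_add hN0, Real.rpow_add hN0]; ring
        rw [e2]
        gcongr
        · have : 2 / (M : ℝ) = 2 * (1 / 2) ^ m := by rw [hM]; push_cast; rw [one_div, inv_pow]; rfl
          rw [this, hθ]
          linarith

theorem sum_ballInd (a : ℕ → ℕ) (N : ℕ) (ε : ℝ) (x : UnitAddCircle) :
    (∑ p ∈ pairSet N, ballInd ε ((pairDiff a p : ℕ) • x)) = (pairCnt a x N ε : ℂ) := by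
  unfold pairCnt ballInd
  rw [Finset.sum_ite]
  simp

open scoped ENNReal in
theorem ae_subseq (δ : ℝ) (hδ : 0 < δ) (hδ1 : δ ≤ 1)
    (a : ℕ → ℕ) (ha : StrictMono a) (C : ℝ)
    (h : ∀ N : ℕ, 1 ≤ N → (addEnergy (firstN a N) : ℝ) ≤ C * (N : ℝ) ^ ((3 : ℝ) - δ))
    (L : ℕ) (hL0 : L ≠ 0) (hL : 4 ≤ L * δ)
    (s : ℝ) (hs : 0 < s) : ∀ᵐ x ∂(AddCircle.haarAddCircle : Measure UnitAddCircle),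
      Tendsto (fun k : ℕ => 2 * pairCnt a x (k ^ L) (s / (k ^ L : ℕ)) / (k ^ L : ℕ)) atTop (nhds (2 * s)) := by
  obtain ⟨K, hK0, hK⟩ := var_N δ hδ hδ1 a ha C h s hs
  obtain ⟨k0, hk0⟩ := exists_nat_gt (2 * s)
  -- the k-th level
  set n : ℕ → ℕ := fun k => (k + (k0 + 1)) ^ L with hn
  have hn1 : ∀ k, 1 ≤ n k := fun k => Nat.one_le_pow _ _ (by omega)
  have hns : ∀ k, 2 * s < n k := fun k => by
    refine hk0.trans_le ?_
    have : k0 ≤ n k := le_trans (by omega : k0 ≤ k + (k0 + 1)) (Nat.le_self_pow hL0 _)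
    exact_mod_cast this
  set g : ℕ → UnitAddCircle → ℝ≥0∞ := fun k x => ENNReal.ofReal (((n k : ℝ) ^ 2)⁻¹) *
    ENNReal.ofReal (‖(∑ p ∈ pairSet (n k), ballInd (s / n k) ((pairDiff a p : ℕ) • x))
      - (pairSet (n k)).card * (2 * (s / n k : ℝ))‖ ^ 2) with hg
  have hm : ∀ k, Measurable (fun x : UnitAddCircle => ENNReal.ofReal (‖(∑ p ∈ pairSet (n k), ballInd (s / n k) ((pairDiff a p : ℕ) • x))
      - (pairSet (n k)).card * (2 * (s / n k : ℝ))‖ ^ 2)) := by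
    intro k
    refine ENNReal.measurable_ofReal.comp (Measurable.pow_const (Measurable.norm ?_) 2)
    refine Measurable.sub_const (Finset.measurable_sum _ fun p _ => ?_) _
    exact (measurable_ballInd _).comp (continuous_const_smul _).measurable
  have hgm : ∀ k, Measurable (g k) := fun k => (hm k).const_mul _
  have hbound : ∀ k, ∫⁻ x, g k x ∂AddCircle.haarAddCircle ≤
      ENNReal.ofReal (K * ((k + (k0 + 1) : ℕ) : ℝ) ^ (-2 : ℝ)) := by
    intro k
    have hp : (0 : ℝ) < n k := by exact_mod_cast hn1 k
    have hq : (1 : ℝ) ≤ ((k + (k0 + 1) : ℕ) : ℝ) := by exact_mod_cast (by omega : 1 ≤ k + (k0 + 1))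
    rw [hg, lintegral_const_mul _ (hm k)]
    refine (mul_le_mul_right (hK (n k) (hn1 k) (hns k)) _).trans ?_
    rw [← ENNReal.ofReal_mul (by positivity)]
    apply ENNReal.ofReal_le_ofReal
    have e : ((n k : ℝ) ^ 2)⁻¹ * (K * (n k : ℝ) ^ (2 - δ / 2)) = K * (n k : ℝ) ^ (-(δ / 2)) := by
      have : (2 - δ / 2 : ℝ) = 2 + -(δ / 2) := by ring
      rw [this, Real.rpow_add hp, Real.rpow_two]
      field_simp
    rw [e]
    gcongr
    rw [hn]
    push_cast
    rw [← Real.rpow_natCast, ← Real.rpow_mul (by positivity)]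
    push_cast at hq
    gcongr
    linarith
  have hsum : ∑' k, ∫⁻ x, g k x ∂AddCircle.haarAddCircle ≠ ⊤ := by
    have hS : Summable (fun k : ℕ => K * ((k + (k0 + 1) : ℕ) : ℝ) ^ (-2 : ℝ)) := by
      apply Summable.mul_left
      exact (summable_nat_add_iff (f := fun k : ℕ => (k : ℝ) ^ (-2 : ℝ)) (k0 + 1)).2
        (Real.summable_nat_rpow.2 (by norm_num))
    exact ne_top_of_le_ne_top hS.tsum_ofReal_ne_top (ENNReal.tsum_le_tsum hbound)
  rw [← lintegral_tsum (fun k => (hgm k).aemeasurable)] at hsum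
  have hae := ae_lt_top (Measurable.ennreal_tsum hgm) hsum
  filter_upwards [hae] with x hx
  have ht := ENNReal.tendsto_atTop_zero_of_tsum_ne_top hx.ne
  rw [← tendsto_add_atTop_iff_nat (k0 + 1)]
  have hntop : Tendsto (fun k => (n k : ℝ)) atTop atTop := by
    refine tendsto_natCast_atTop_atTop.comp ?_
    refine tendsto_atTop_mono (fun k => ?_) tendsto_id
    exact le_trans (by simp : id k ≤ k + (k0 + 1)) (Nat.le_self_pow hL0 _)
  set D : ℕ → ℝ := fun k => pairCnt a x (n k) (s / n k) / n k - s * (n k - 1) / n k with hD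
  have hgD : ∀ k, g k x = ENNReal.ofReal (D k ^ 2) := by
    intro k
    have hp : (0 : ℝ) < n k := by exact_mod_cast hn1 k
    rw [hg]
    simp only
    rw [← ENNReal.ofReal_mul (by positivity), sum_ballInd]
    congr 1
    have hcard := card_pairSet (n k)
    have e1 : ((pairSet (n k)).card : ℝ) * (2 * (s / n k)) = s * (n k - 1) := by
      have : ((pairSet (n k)).card : ℝ) * (2 * (s / n k)) = (2 * ((pairSet (n k)).card : ℝ)) * (s / n k) := by ring
      rw [this, hcard]; field_simp
    have e2 : ((pairCnt a x (n k) (s / n k) : ℂ) - (pairSet (n k)).card * (2 * (s / n k : ℝ))) =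
      ((pairCnt a x (n k) (s / n k) - s * (n k - 1) : ℝ) : ℂ) := by
      rw [← e1]; push_cast; ring
    rw [e2, Complex.norm_real, Real.norm_eq_abs, sq_abs, hD]
    field_simp
  have hD0 : Tendsto D atTop (nhds 0) := by
    simp_rw [hgD] at ht
    have h1 := (ENNReal.tendsto_toReal ENNReal.zero_ne_top).comp ht
    have h2 : Tendsto (fun k => D k ^ 2) atTop (nhds 0) := by
      refine h1.congr fun k => ?_
      simp [ENNReal.toReal_ofReal (sq_nonneg _)]
    have h3 := h2.sqrt
    rw [Real.sqrt_zero] at h3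
    simp_rw [Real.sqrt_sq_eq_abs] at h3
    exact (tendsto_zero_iff_abs_tendsto_zero _).2 h3
  have hlim : Tendsto (fun k => 2 * D k + (2 * s - 2 * s / n k)) atTop (nhds (2 * 0 + (2 * s - 0))) :=
    (hD0.const_mul 2).add (tendsto_const_nhds.sub (hntop.const_div_atTop _))
  rw [mul_zero, zero_add, sub_zero] at hlim
  refine hlim.congr fun k => ?_
  have hp : (0 : ℝ) < n k := by exact_mod_cast hn1 k
  change _ = 2 * pairCnt a x (n k) (s / n k) / n k
  rw [hD]
  field_simp
  ring

theorem pairCnt_mono (a : ℕ → ℕ) (x : UnitAddCircle) {N N' : ℕ} (hN : N ≤ N') {ε ε' : ℝ} (hε : ε ≤ ε') :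
    pairCnt a x N ε ≤ pairCnt a x N' ε' := by
  unfold pairCnt
  have : (pairSet N).filter (fun p => ‖(pairDiff a p : ℕ) • x‖ ≤ ε) ⊆
      (pairSet N').filter (fun p => ‖(pairDiff a p : ℕ) • x‖ ≤ ε') := by
    intro p hp
    simp only [pairSet, Finset.mem_filter, Finset.mem_product, Finset.mem_Icc] at hp ⊢
    exact ⟨⟨⟨⟨hp.1.1.1.1, hp.1.1.1.2.trans hN⟩, hp.1.1.2.1, hp.1.1.2.2.trans hN⟩, hp.1.2⟩, hp.2.trans hε⟩
  exact_mod_cast Finset.card_le_card this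

theorem sandwich (c : ℕ → ℝ → ℝ) (hc0 : ∀ N ε, 0 ≤ c N ε)
    (hc : ∀ {N N' : ℕ}, N ≤ N' → ∀ {ε ε' : ℝ}, ε ≤ ε' → c N ε ≤ c N' ε') (L : ℕ) (hL : L ≠ 0)
    (hq : ∀ q : ℚ, 0 < q → Tendsto (fun k : ℕ => 2 * c (k ^ L) ((q : ℝ) / (k ^ L : ℕ)) / (k ^ L : ℕ)) atTop
      (nhds (2 * (q : ℝ)))) (s : ℝ) (hs : 0 < s) :
    Tendsto (fun N : ℕ => 2 * c N (s / N) / N) atTop (nhds (2 * s)) := by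
  have hk : ∀ N : ℕ, ∃ k : ℕ, k ^ L ≤ N ∧ N < (k + 1) ^ L := by
    intro N
    have hex : ∃ k : ℕ, N < (k + 1) ^ L := ⟨N, (Nat.lt_succ_self N).trans_le (Nat.le_self_pow hL _)⟩
    refine ⟨Nat.find hex, ?_, Nat.find_spec hex⟩
    rcases Nat.eq_zero_or_pos (Nat.find hex) with h | h
    · rw [h, zero_pow hL]; exact Nat.zero_le _
    · have := Nat.find_min hex (Nat.sub_lt h one_pos)
      rw [show Nat.find hex - 1 + 1 = Nat.find hex by omega] at this
      exact not_lt.1 this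
  choose κ hκ1 hκ2 using hk
  have hκ : Tendsto κ atTop atTop := by
    rw [tendsto_atTop]
    intro b
    filter_upwards [eventually_ge_atTop (b ^ L)] with N hN
    by_contra hlt
    have : (κ N + 1) ^ L ≤ b ^ L := Nat.pow_le_pow_left (by omega) L
    exact absurd (hκ2 N) (by omega)
  -- the ratio
  have hratio : Tendsto (fun k : ℕ => (((k + 1) ^ L : ℕ) : ℝ) / ((k ^ L : ℕ) : ℝ)) atTop (nhds 1) := by
    have h1 : Tendsto (fun k : ℕ => ((1 + 1 / (k : ℝ)) ^ L)) atTop (nhds ((1 + 0) ^ L)) :=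
      (tendsto_const_nhds.add tendsto_one_div_atTop_nhds_zero_nat).pow L
    simp only [add_zero, one_pow] at h1
    refine h1.congr' ?_
    filter_upwards [eventually_ge_atTop 1] with k hk
    have : (k : ℝ) ≠ 0 := by positivity
    push_cast
    rw [← div_pow]
    congr 1
    field_simp
  have hratio' : Tendsto (fun k : ℕ => ((k ^ L : ℕ) : ℝ) / (((k + 1) ^ L : ℕ) : ℝ)) atTop (nhds 1) := by
    have := hratio.inv₀ one_ne_zero
    simpa using this
  rw [tendsto_order]
  constructor
  · intro l hl
    obtain ⟨q, hq1, hq2⟩ := exists_rat_btwn (show max (l / 2) 0 < s from max_lt (by linarith) hs)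
    have hq0 : (0 : ℝ) < q := (le_max_right _ _).trans_lt hq1
    have hql : l < 2 * q := by have := (le_max_left (l / 2) 0).trans_lt hq1; linarith
    have hlim := (hq q (by exact_mod_cast hq0)).mul hratio'
    rw [mul_one] at hlim
    have ev1 := hlim.eventually (lt_mem_nhds hql)
    have hlim2 := hratio.const_mul (q : ℝ)
    rw [mul_one] at hlim2
    have ev2 := hlim2.eventually (gt_mem_nhds hq2)
    filter_upwards [hκ.eventually ev1, hκ.eventually ev2, hκ.eventually (eventually_ge_atTop 1)] with N h1 h2 h3
    set k := κ N
    have p1 : (0 : ℝ) < (k ^ L : ℕ) := by exact_mod_cast Nat.pow_pos (by omega)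
    have p2 : (0 : ℝ) < ((k + 1) ^ L : ℕ) := by exact_mod_cast Nat.pow_pos (by omega)
    have hN1 : ((k ^ L : ℕ) : ℝ) ≤ N := by exact_mod_cast hκ1 N
    have hN2 : (N : ℝ) ≤ ((k + 1) ^ L : ℕ) := by exact_mod_cast (hκ2 N).le
    have pN : (0 : ℝ) < N := p1.trans_le hN1
    have hε : (q : ℝ) / (k ^ L : ℕ) ≤ s / N := by
      rw [div_le_div_iff₀ p1 pN]
      rw [← mul_div_assoc, div_lt_iff₀ p1] at h2
      calc (q : ℝ) * N ≤ q * ((k + 1) ^ L : ℕ) := by gcongr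
        _ ≤ _ := h2.le
    refine h1.trans_le ?_
    rw [div_mul_div_cancel₀ p1.ne']
    have := hc0 (k ^ L) ((q : ℝ) / (k ^ L : ℕ))
    have := hc (hκ1 N) hε
    exact div_le_div₀ (mul_nonneg two_pos.le (hc0 _ _)) (by linarith) pN hN2
  · intro u hu
    obtain ⟨q, hq1, hq2⟩ := exists_rat_btwn (show s < u / 2 by linarith)
    have hq0 : (0 : ℝ) < q := hs.trans hq1
    have hqu : 2 * (q : ℝ) < u := by linarith
    have hlim := (((tendsto_add_atTop_iff_nat 1).2 (hq q (by exact_mod_cast hq0)))).mul hratio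
    rw [mul_one] at hlim
    have ev1 := hlim.eventually (gt_mem_nhds hqu)
    have hlim2 := hratio.const_mul s
    rw [mul_one] at hlim2
    have ev2 := hlim2.eventually (gt_mem_nhds hq1)
    filter_upwards [hκ.eventually ev1, hκ.eventually ev2, hκ.eventually (eventually_ge_atTop 1)] with N h1 h2 h3
    set k := κ N
    have p1 : (0 : ℝ) < (k ^ L : ℕ) := by exact_mod_cast Nat.pow_pos (by omega)
    have p2 : (0 : ℝ) < ((k + 1) ^ L : ℕ) := by exact_mod_cast Nat.pow_pos (by omega)
    have hN1 : ((k ^ L : ℕ) : ℝ) ≤ N := by exact_mod_cast hκ1 N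
    have pN : (0 : ℝ) < N := p1.trans_le hN1
    have hε : s / N ≤ (q : ℝ) / ((k + 1) ^ L : ℕ) := by
      rw [div_le_div_iff₀ pN p2]
      rw [← mul_div_assoc, div_lt_iff₀ p1] at h2
      calc s * ((k + 1) ^ L : ℕ) ≤ q * (k ^ L : ℕ) := h2.le
        _ ≤ _ := by gcongr
    refine lt_of_le_of_lt ?_ h1
    rw [div_mul_div_cancel₀ p2.ne']
    have := hc0 ((k + 1) ^ L) ((q : ℝ) / ((k + 1) ^ L : ℕ))
    have := hc (hκ2 N).le hε
    gcongr

/-- **(Aistleitner–Larcher–Lewko / Harman)** If `E(A_N) ≤ C·N^{3−δ}` for all `N ≥ 1`,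
then `𝒜` is metric Poissonian. -/
theorem metricPoissonian_of_small_energy (δ : ℝ) (hδ : 0 < δ)
    (a : ℕ → ℕ) (ha : StrictMono a) (C : ℝ)
    (h : ∀ N : ℕ, 1 ≤ N → (addEnergy (firstN a N) : ℝ) ≤ C * (N : ℝ) ^ ((3 : ℝ) - δ)) :
    MetricPoissonian a := by
  have hC0 : 0 ≤ C := by
    have := h 1 le_rfl
    simp at this
    exact le_trans (by positivity) this
  have hδ' : 0 < min δ 1 := lt_min hδ one_pos
  have h' : ∀ N : ℕ, 1 ≤ N → (addEnergy (firstN a N) : ℝ) ≤ C * (N : ℝ) ^ ((3 : ℝ) - min δ 1) := by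
    intro N hN
    refine (h N hN).trans ?_
    have : (1 : ℝ) ≤ N := by exact_mod_cast hN
    gcongr
    exact min_le_left _ _
  obtain ⟨L, hL⟩ := exists_nat_gt (4 / min δ 1)
  have hL' : 4 ≤ L * min δ 1 := by
    rw [div_lt_iff₀ hδ'] at hL
    exact hL.le
  have hL0 : L ≠ 0 := by
    rintro rfl
    norm_num at hL'
  have hae : ∀ᵐ x ∂(AddCircle.haarAddCircle : Measure UnitAddCircle), ∀ q : ℚ, 0 < q →
      Tendsto (fun k : ℕ => 2 * pairCnt a x (k ^ L) ((q : ℝ) / (k ^ L : ℕ)) / (k ^ L : ℕ)) atTop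
        (nhds (2 * (q : ℝ))) := by
    rw [ae_all_iff]
    intro q
    by_cases hq : 0 < q
    · filter_upwards [ae_subseq (min δ 1) hδ' (min_le_right _ _) a ha C h' L hL0 hL' q
        (by exact_mod_cast hq)] with x hx _
      exact hx
    · exact Eventually.of_forall fun x hh => absurd hh hq
  have hvol : (volume : Measure UnitAddCircle) = AddCircle.haarAddCircle := by
    rw [AddCircle.volume_eq_smul_haarAddCircle]; simp
  rw [← hvol] at hae
  have hae2 := (UnitAddCircle.measurePreserving_mk 0).quasiMeasurePreserving.ae hae
  unfold MetricPoissonian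
  rw [zero_add, Measure.restrict_congr_set Ioc_ae_eq_Icc] at hae2
  filter_upwards [hae2] with α hα s hs
  have := sandwich (fun N ε => pairCnt a (α : UnitAddCircle) N ε)
    (fun N ε => by unfold pairCnt; positivity) (fun hN _ _ hε => pairCnt_mono a _ hN hε) L hL0 hα s hs
  refine this.congr fun N => ?_
  rw [pairCorr_eq a ha]
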